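/- Let φ: ℝ² → ℝ be a smooth (C⁴) function compactly supported in the open unit disk, and let f = dd⊥φ, i.e. f11 = -∂²φ/∂x1∂x2, f12 = (1/2)·(∂²φ/∂x1² - ∂²φ/∂x2²), f22 = ∂²φ/∂x1∂x2. Then φ satisfies, at every x ∈ ℝ², the second-order partial differential equation (1 + 2·u1²)·∂²φ/∂x1²(x) + (u1² - u2²)·∂²φ/∂x2²(x) = -(1/u2)·X_{e2}(D_u D_v (Mf))(x). -/

import Mathlib

open MeasureTheory

noncomputable section

/-- Rotation of a vector by 90 degrees: `w⊥ = (-w2, w1)`. -/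
def perp (w : ℝ × ℝ) : ℝ × ℝ := (-w.2, w.1)

/-- Divergent beam transform `X_w h (x) = ∫_0^∞ h(x + t w) dt`. -/
def Xray (w : ℝ × ℝ) (h : ℝ × ℝ → ℝ) (x : ℝ × ℝ) : ℝ :=
  ∫ t in Set.Ioi (0:ℝ), h (x + t • w)

/-- First moment divergent beam transform `X¹_w h (x) = ∫_0^∞ t·h(x + t w) dt`. -/
def Xray1 (w : ℝ × ℝ) (h : ℝ × ℝ → ℝ) (x : ℝ × ℝ) : ℝ :=
  ∫ t in Set.Ioi (0:ℝ), t * h (x + t • w)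

/-- Directional derivative `D_w h = w1 ∂h/∂x1 + w2 ∂h/∂x2`. -/
def Dw (w : ℝ × ℝ) (h : ℝ × ℝ → ℝ) (x : ℝ × ℝ) : ℝ :=
  fderiv ℝ h x w

/-- Partial derivative in the first coordinate. -/
def pdx (h : ℝ × ℝ → ℝ) : ℝ × ℝ → ℝ := Dw (1, 0) h

/-- Partial derivative in the second coordinate. -/
def pdy (h : ℝ × ℝ → ℝ) : ℝ × ℝ → ℝ := Dw (0, 1) h

/-- The open unit disk in ℝ². -/
def unitDisk : Set (ℝ × ℝ) := {x | x.1 ^ 2 + x.2 ^ 2 < 1}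

/-- `⟨f, w²⟩ = f11 w1² + 2 f12 w1 w2 + f22 w2²`. -/
def proj2 (f11 f12 f22 : ℝ × ℝ → ℝ) (w : ℝ × ℝ) (x : ℝ × ℝ) : ℝ :=
  f11 x * w.1 ^ 2 + 2 * f12 x * w.1 * w.2 + f22 x * w.2 ^ 2

/-- `⟨f, w ⊙ w⊥⟩ = -f11 w1 w2 + f12 (w1² - w2²) + f22 w1 w2`. -/
def projMix (f11 f12 f22 : ℝ × ℝ → ℝ) (w : ℝ × ℝ) (x : ℝ × ℝ) : ℝ :=
  -(f11 x) * w.1 * w.2 + f12 x * (w.1 ^ 2 - w.2 ^ 2) + f22 x * w.1 * w.2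

/-- V-line transform of a scalar function. -/
def Vlt (u v : ℝ × ℝ) (h : ℝ × ℝ → ℝ) (x : ℝ × ℝ) : ℝ := Xray u h x + Xray v h x

/-- Longitudinal V-line transform. -/
def Lf (u v : ℝ × ℝ) (f11 f12 f22 : ℝ × ℝ → ℝ) (x : ℝ × ℝ) : ℝ :=
  Xray u (proj2 f11 f12 f22 u) x + Xray v (proj2 f11 f12 f22 v) x

/-- Transverse V-line transform. -/
def Tf (u v : ℝ × ℝ) (f11 f12 f22 : ℝ × ℝ → ℝ) (x : ℝ × ℝ) : ℝ :=
  Xray u (proj2 f11 f12 f22 (perp u)) x + Xray v (proj2 f11 f12 f22 (perp v)) x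

/-- Mixed V-line transform. -/
def Mf (u v : ℝ × ℝ) (f11 f12 f22 : ℝ × ℝ → ℝ) (x : ℝ × ℝ) : ℝ :=
  Xray u (projMix f11 f12 f22 u) x + Xray v (projMix f11 f12 f22 v) x

/-- First moment longitudinal V-line transform. -/
def L1f (u v : ℝ × ℝ) (f11 f12 f22 : ℝ × ℝ → ℝ) (x : ℝ × ℝ) : ℝ :=
  Xray1 u (proj2 f11 f12 f22 u) x + Xray1 v (proj2 f11 f12 f22 v) x

lemma exists_forall_lt_comp_add_smul_eq_zero {E : Type*} [NormedAddCommGroup E]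
    {g : ℝ × ℝ → E} (hg : HasCompactSupport g) {w : ℝ × ℝ} (hw : w ≠ 0) (x : ℝ × ℝ) :
    ∃ T : ℝ, ∀ y ∈ Metric.ball x 1, ∀ t, T < t → g (y + t • w) = 0 := by
  obtain ⟨R, hR⟩ := hg.isBounded.exists_norm_le
  have hw' : 0 < ‖w‖ := norm_pos_iff.mpr hw
  refine ⟨max 0 ((R + ‖x‖ + 1) / ‖w‖), fun y hy t ht => ?_⟩
  by_contra h
  have h1 := hR _ (subset_tsupport _ (Function.mem_support.mpr h))
  have ht0 : 0 < t := (le_max_left _ _).trans_lt ht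
  have h2 : R + ‖x‖ + 1 < t * ‖w‖ := (div_lt_iff₀ hw').mp ((le_max_right _ _).trans_lt ht)
  have h3 : ‖y‖ ≤ ‖x‖ + 1 := by
    have h5 : ‖y - x‖ < 1 := by simpa [dist_eq_norm] using hy
    have h6 := norm_le_norm_add_norm_sub x y
    linarith [norm_sub_rev x y]
  have h4 : ‖t • w‖ ≤ ‖y + t • w‖ + ‖y‖ := by
    simpa using norm_sub_le (y + t • w) y
  rw [norm_smul, Real.norm_eq_abs, abs_of_pos ht0] at h4
  linarith

lemma integrableOn_comp_add_smul {E : Type*} [NormedAddCommGroup E]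
    {g : ℝ × ℝ → E} (hg : Continuous g) (hs : HasCompactSupport g) {w : ℝ × ℝ} (hw : w ≠ 0)
    (x : ℝ × ℝ) : IntegrableOn (fun t : ℝ => g (x + t • w)) (Set.Ioi 0) := by
  obtain ⟨T, hT⟩ := exists_forall_lt_comp_add_smul_eq_zero hs hw x
  have hc : Continuous fun t : ℝ => g (x + t • w) := by fun_prop
  refine (hc.integrableOn_Icc (a := 0) (b := T)).of_forall_sdiff_eq_zero measurableSet_Ioi ?_
  rintro t ⟨ht, ht'⟩
  refine hT x (Metric.mem_ball_self one_pos) t ?_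
  by_contra h
  exact ht' ⟨le_of_lt ht, not_lt.mp h⟩

lemma hasFDerivAt_Xray {g : ℝ × ℝ → ℝ} (hg : ContDiff ℝ 1 g) (hs : HasCompactSupport g)
    {w : ℝ × ℝ} (hw : w ≠ 0) (x : ℝ × ℝ) :
    HasFDerivAt (Xray w g) (∫ t in Set.Ioi (0 : ℝ), fderiv ℝ g (x + t • w)) x := by
  have hs' : HasCompactSupport (fderiv ℝ g) := hs.fderiv ℝ
  have hg' : Continuous (fderiv ℝ g) := hg.continuous_fderiv one_ne_zero
  obtain ⟨T, hT⟩ := exists_forall_lt_comp_add_smul_eq_zero hs' hw x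
  obtain ⟨C, hC⟩ := hs'.exists_bound_of_continuous hg'
  refine hasFDerivAt_integral_of_dominated_of_fderiv_le
    (F := fun y t => g (y + t • w)) (F' := fun y t => fderiv ℝ g (y + t • w))
    (bound := (Set.Icc 0 T).indicator fun _ => C)
    (Metric.ball_mem_nhds x one_pos) ?_ ?_ ?_ ?_ ?_ ?_
  · refine Filter.Eventually.of_forall fun y => ?_
    have : Continuous fun t : ℝ => g (y + t • w) := by
      have := hg.continuous
      fun_prop
    exact this.aestronglyMeasurable
  · exact integrableOn_comp_add_smul hg.continuous hs hw x
  · exact (integrableOn_comp_add_smul hg' hs' hw x).aestronglyMeasurable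
  · filter_upwards [ae_restrict_mem measurableSet_Ioi] with t ht y hy
    by_cases h : t ≤ T
    · rw [Set.indicator_of_mem (Set.mem_Icc.mpr ⟨le_of_lt ht, h⟩)]
      exact hC _
    · rw [hT y hy t (not_le.mp h), Set.indicator_of_notMem fun h' => h h'.2, norm_zero]
  · have : Integrable ((Set.Icc 0 T).indicator fun _ : ℝ => C) :=
      (integrableOn_const (by simp)).integrable_indicator measurableSet_Icc
    exact this.integrableOn
  · refine Filter.Eventually.of_forall fun t y _ => ?_
    have h := (hg.differentiable one_ne_zero (y + t • w)).hasFDerivAt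
    exact (hasFDerivAt_comp_add_right (t • w)).mpr h

lemma Dw_Xray {g : ℝ × ℝ → ℝ} (hg : ContDiff ℝ 1 g) (hs : HasCompactSupport g)
    {w : ℝ × ℝ} (hw : w ≠ 0) (v : ℝ × ℝ) : Dw v (Xray w g) = Xray w (Dw v g) := by
  funext x
  rw [Dw, (hasFDerivAt_Xray hg hs hw x).fderiv,
    ContinuousLinearMap.integral_apply
      (integrableOn_comp_add_smul (hg.continuous_fderiv one_ne_zero) (hs.fderiv ℝ) hw x)]
  rfl

lemma hasCompactSupport_Dw {g : ℝ × ℝ → ℝ} (hs : HasCompactSupport g) (v : ℝ × ℝ) :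
    HasCompactSupport (Dw v g) :=
  hs.fderiv_apply ℝ v

lemma contDiff_Dw {n m : WithTop ℕ∞} {g : ℝ × ℝ → ℝ} (hg : ContDiff ℝ n g) (h : m + 1 ≤ n)
    (v : ℝ × ℝ) : ContDiff ℝ m (Dw v g) :=
  (hg.fderiv_right h).clm_apply contDiff_const

lemma Xray_Dw_self {g : ℝ × ℝ → ℝ} (hg : ContDiff ℝ 1 g) (hs : HasCompactSupport g)
    {w : ℝ × ℝ} (hw : w ≠ 0) (x : ℝ × ℝ) : Xray w (Dw w g) x = -g x := by
  obtain ⟨T, hT⟩ := exists_forall_lt_comp_add_smul_eq_zero hs hw x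
  have hderiv : ∀ t : ℝ, HasDerivAt (fun t : ℝ => g (x + t • w)) (Dw w g (x + t • w)) t := by
    intro t
    have h1 : HasDerivAt (fun t : ℝ => x + t • w) w t := by
      simpa using ((hasDerivAt_id t).smul_const w).const_add x
    exact (hg.differentiable one_ne_zero (x + t • w)).hasFDerivAt.comp_hasDerivAt t h1
  have hlim : Filter.Tendsto (fun t : ℝ => g (x + t • w)) Filter.atTop (nhds 0) := by
    refine tendsto_const_nhds.congr' ?_
    filter_upwards [Filter.eventually_gt_atTop T] with t ht
    exact (hT x (Metric.mem_ball_self one_pos) t ht).symm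
  have h := integral_Ioi_of_hasDerivAt_of_tendsto' (a := 0) (fun t _ => hderiv t)
    (integrableOn_comp_add_smul (contDiff_Dw (m := 0) hg (by simp) w).continuous
      (hasCompactSupport_Dw hs w) hw x) hlim
  simpa [Xray] using h

lemma Dw_Xray_self {g : ℝ × ℝ → ℝ} (hg : ContDiff ℝ 1 g) (hs : HasCompactSupport g)
    {w : ℝ × ℝ} (hw : w ≠ 0) : Dw w (Xray w g) = -g := by
  rw [Dw_Xray hg hs hw]
  exact funext (Xray_Dw_self hg hs hw)

lemma Dw_comm {g : ℝ × ℝ → ℝ} (hg : ContDiff ℝ 2 g) (v w : ℝ × ℝ) :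
    Dw v (Dw w g) = Dw w (Dw v g) := by
  funext x
  have hd : DifferentiableAt ℝ (fderiv ℝ g) x :=
    (hg.fderiv_right (m := 1) (by norm_num)).differentiable one_ne_zero x
  have key : ∀ a b : ℝ × ℝ, Dw a (Dw b g) x = fderiv ℝ (fderiv ℝ g) x a b := by
    intro a b
    have h := hd.hasFDerivAt.clm_apply (hasFDerivAt_const b x)
    change fderiv ℝ (fun y => fderiv ℝ g y b) x a = _
    rw [h.fderiv]
    simp
  rw [key, key]
  exact (hg.contDiffAt.isSymmSndFDerivAt (by simp)).eq v w

lemma Dw_eq (w : ℝ × ℝ) (g : ℝ × ℝ → ℝ) (x : ℝ × ℝ) :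
    Dw w g x = w.1 * pdx g x + w.2 * pdy g x := by
  have hw : w = w.1 • ((1, 0) : ℝ × ℝ) + w.2 • ((0, 1) : ℝ × ℝ) := by ext <;> simp
  conv_lhs => rw [hw]
  simp only [Dw, pdx, pdy, map_add, map_smul, smul_eq_mul]

lemma Dw_linear_combination {A B C : ℝ × ℝ → ℝ} (hA : Differentiable ℝ A)
    (hB : Differentiable ℝ B) (hC : Differentiable ℝ C) (a b c : ℝ) (w x : ℝ × ℝ) :
    Dw w (fun y => a * A y + b * B y + c * C y) x =
      a * Dw w A x + b * Dw w B x + c * Dw w C x := by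
  have h := (((hA x).hasFDerivAt.const_mul a).add ((hB x).hasFDerivAt.const_mul b)).add
    ((hC x).hasFDerivAt.const_mul c)
  exact DFunLike.congr_fun h.fderiv w

lemma Dw_Dw_Xray_add_Xray {g h : ℝ × ℝ → ℝ} (hg : ContDiff ℝ 2 g) (hgs : HasCompactSupport g)
    (hh : ContDiff ℝ 1 h) (hhs : HasCompactSupport h) {u v : ℝ × ℝ} (hu : u ≠ 0) (hv : v ≠ 0) :
    Dw u (Dw v (fun x => Xray u g x + Xray v h x)) = fun x => -Dw v g x - Dw u h x := by
  have hg1 : ContDiff ℝ 1 g := hg.of_le (by norm_num)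
  have hDg : ContDiff ℝ 1 (Dw v g) := contDiff_Dw hg (by norm_num) v
  have hDgs := hasCompactSupport_Dw hgs v
  have h1 : Dw v (fun x => Xray u g x + Xray v h x) = fun x => Xray u (Dw v g) x - h x := by
    funext x
    have hsum := (hasFDerivAt_Xray hg1 hgs hu x).differentiableAt.hasFDerivAt.add
      (hasFDerivAt_Xray hh hhs hv x).differentiableAt.hasFDerivAt
    have e : Dw v (fun x => Xray u g x + Xray v h x) x
        = Dw v (Xray u g) x + Dw v (Xray v h) x :=
      DFunLike.congr_fun hsum.fderiv v
    rw [e, Dw_Xray hg1 hgs hu, Dw_Xray_self hh hhs hv]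
    simp [sub_eq_add_neg]
  funext x
  have hdiff := (hasFDerivAt_Xray hDg hDgs hu x).differentiableAt.hasFDerivAt.sub
    (hh.differentiable one_ne_zero x).hasFDerivAt
  have e : Dw u (fun x => Xray u (Dw v g) x - h x) x
      = Dw u (Xray u (Dw v g)) x - Dw u h x :=
    DFunLike.congr_fun hdiff.fderiv u
  rw [h1, e, Dw_Xray_self hDg hDgs hu]
  rfl

lemma hasCompactSupport_of_tsupport_subset_unitDisk {E : Type*} [Zero E] {φ : ℝ × ℝ → E}
    (h : tsupport φ ⊆ unitDisk) : HasCompactSupport φ := by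
  refine Metric.isCompact_of_isClosed_isBounded (isClosed_tsupport φ)
    (isBounded_iff_forall_norm_le.mpr ⟨1, fun x hx => ?_⟩)
  have hx' : x.1 ^ 2 + x.2 ^ 2 < 1 := h hx
  rw [Prod.norm_def, max_le_iff, Real.norm_eq_abs, Real.norm_eq_abs]
  exact ⟨abs_le_one_iff_mul_self_le_one.mpr (by nlinarith [sq_nonneg x.2]),
    abs_le_one_iff_mul_self_le_one.mpr (by nlinarith [sq_nonneg x.1])⟩

lemma hasCompactSupport_linear_combination {A B C : ℝ × ℝ → ℝ} (hA : HasCompactSupport A)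
    (hB : HasCompactSupport B) (hC : HasCompactSupport C) (a b c : ℝ) :
    HasCompactSupport (fun y => a * A y + b * B y + c * C y) :=
  ((hA.mul_left (f := fun _ => a)).add (hB.mul_left (f := fun _ => b))).add
    (hC.mul_left (f := fun _ => c))

theorem stmt_3 (u1 u2 : ℝ) (hu1 : 0 < u1) (hu2 : 0 < u2) (huv : u1 ^ 2 + u2 ^ 2 = 1)
    (φ : ℝ × ℝ → ℝ) (hφ : ContDiff ℝ 4 φ) (hφsupp : tsupport φ ⊆ unitDisk)
    (f11 f12 f22 : ℝ × ℝ → ℝ)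
    (hf11 : f11 = fun x => -(pdx (pdy φ) x))
    (hf12 : f12 = fun x => (1 / 2) * (pdx (pdx φ) x - pdy (pdy φ) x))
    (hf22 : f22 = pdx (pdy φ)) :
    ∀ x : ℝ × ℝ,
      (1 + 2 * u1 ^ 2) * pdx (pdx φ) x + (u1 ^ 2 - u2 ^ 2) * pdy (pdy φ) x =
        -(1 / u2) * Xray (0, 1) (Dw (u1, u2) (Dw (-u1, u2) (Mf (u1, u2) (-u1, u2) f11 f12 f22))) x := by
  have hφs := hasCompactSupport_of_tsupport_subset_unitDisk hφsupp
  have hφx : ContDiff ℝ 3 (pdx φ) := contDiff_Dw hφ (by norm_num) _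
  have hφy : ContDiff ℝ 3 (pdy φ) := contDiff_Dw hφ (by norm_num) _
  set A := pdx (pdx φ) with hA
  set B := pdx (pdy φ) with hB
  set C := pdy (pdy φ) with hC
  have cA : ContDiff ℝ 2 A := contDiff_Dw hφx (by norm_num) _
  have cB : ContDiff ℝ 2 B := contDiff_Dw hφy (by norm_num) _
  have cC : ContDiff ℝ 2 C := contDiff_Dw hφy (by norm_num) _
  have sA : HasCompactSupport A := hasCompactSupport_Dw (hasCompactSupport_Dw hφs _) _
  have sB : HasCompactSupport B := hasCompactSupport_Dw (hasCompactSupport_Dw hφs _) _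
  have sC : HasCompactSupport C := hasCompactSupport_Dw (hasCompactSupport_Dw hφs _) _
  have dA := cA.differentiable two_ne_zero
  have dB := cB.differentiable two_ne_zero
  have dC := cC.differentiable two_ne_zero
  have hBA : pdx B = pdy A := by
    have h1 : B = pdy (pdx φ) := Dw_comm (hφ.of_le (by norm_num)) _ _
    rw [h1]
    exact Dw_comm (hφx.of_le (by norm_num)) _ _
  have hCB : pdx C = pdy B := Dw_comm (hφy.of_le (by norm_num)) _ _
  have hmix : ∀ w : ℝ × ℝ, projMix f11 f12 f22 w = fun y =>
      ((w.1 ^ 2 - w.2 ^ 2) / 2) * A y + (2 * w.1 * w.2) * B y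
        + (-(w.1 ^ 2 - w.2 ^ 2) / 2) * C y := by
    intro w
    funext y
    simp only [projMix, hf11, hf12, hf22]
    ring
  have cmix : ∀ w, ContDiff ℝ 2 (projMix f11 f12 f22 w) := by
    intro w
    rw [hmix]
    fun_prop
  have smix : ∀ w, HasCompactSupport (projMix f11 f12 f22 w) := by
    intro w
    rw [hmix]
    exact hasCompactSupport_linear_combination sA sB sC _ _ _
  have hu : ((u1, u2) : ℝ × ℝ) ≠ 0 := fun h => hu2.ne' (congrArg Prod.snd h)
  have hv : ((-u1, u2) : ℝ × ℝ) ≠ 0 := fun h => hu2.ne' (congrArg Prod.snd h)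
  have he : ((0, 1) : ℝ × ℝ) ≠ 0 := fun h => one_ne_zero (congrArg Prod.snd h)
  have hDD : Dw (u1, u2) (Dw (-u1, u2) (Mf (u1, u2) (-u1, u2) f11 f12 f22)) =
      Dw (0, 1) (fun y => (u2 * (1 + 2 * u1 ^ 2)) * A y + 0 * B y
        + (u2 * (u1 ^ 2 - u2 ^ 2)) * C y) := by
    have h := Dw_Dw_Xray_add_Xray (cmix (u1, u2)) (smix (u1, u2))
      ((cmix (-u1, u2)).of_le (by norm_num)) (smix (-u1, u2)) hu hv
    refine h.trans (funext fun y => ?_)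
    rw [hmix, hmix, Dw_linear_combination dA dB dC, Dw_linear_combination dA dB dC,
      Dw_linear_combination dA dB dC]
    simp only [Dw_eq _ _ y, hBA, hCB]
    linear_combination (u2 * pdy A y) * huv
  have cDD : ContDiff ℝ 2 (fun y => (u2 * (1 + 2 * u1 ^ 2)) * A y + 0 * B y
      + (u2 * (u1 ^ 2 - u2 ^ 2)) * C y) := by
    fun_prop
  intro x
  rw [hDD, Xray_Dw_self (cDD.of_le (by norm_num)) (hasCompactSupport_linear_combination sA sB sC _ _ _) he]
  field_simp
  ring
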